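/- For every natural number m, the set S_m of all homeomorphisms h of the Cantor space for which there exist a partition P of mesh < 1/m and a multiple q of m such that every connected component of Γ(h,P) is a balanced dumbbell with plate weight q! containing both a left and a right loop of h, is an open and dense subset of the space of homeomorphisms of the Cantor space with the uniform metric. -/

import Mathlib

noncomputable def cantorDist (σ τ : ℕ → Bool) : ℝ :=
  letI := Classical.propDecidable (∃ n, σ n ≠ τ n)
  if h : ∃ n, σ n ≠ τ n then 1 / (Nat.find h + 1) else 0

def IsPartition (P : Finset (Set (ℕ → Bool))) : Prop :=
  (∀ a ∈ P, IsClopen a ∧ a.Nonempty) ∧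
  (∀ a ∈ P, ∀ b ∈ P, a ≠ b → Disjoint a b) ∧
  ⋃₀ (P : Set (Set (ℕ → Bool))) = Set.univ

noncomputable def cantorDiam (A : Set (ℕ → Bool)) : ℝ :=
  sSup {r | ∃ σ ∈ A, ∃ τ ∈ A, r = cantorDist σ τ}

noncomputable def mesh (C : Set (Set (ℕ → Bool))) : ℝ :=
  sSup (cantorDiam '' C)

def gammaEdge (f : (ℕ → Bool) → (ℕ → Bool)) (a b : Set (ℕ → Bool)) : Prop :=
  (f '' a ∩ b).Nonempty

def balloonEdge (s m : ℕ) (a b : Fin (s + m)) : Prop :=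
  b.val = a.val + 1 ∨ (a.val = s + m - 1 ∧ b.val = s)

def dumbbellEdge (r s t : ℕ) (a b : Fin (r + s + t)) : Prop :=
  (b.val = a.val + 1 ∧ a.val + 1 ≠ r) ∨
  (a.val = r - 1 ∧ b.val = 0) ∨
  (a.val = 0 ∧ b.val = r) ∨
  (a.val = r + s + t - 1 ∧ b.val = r + s)

/-- Property (P) of the paper, for a fixed `m`: there are a partition of mesh `< 1/m`
and a multiple `q` of `m` such that every component of `Γ(h,P)` is a balanced dumbbell
with plate weight `q!` containing both a left and a right loop of `h`. -/
def BalancedDumbbellProp (m : ℕ) (h : (ℕ → Bool) ≃ₜ (ℕ → Bool)) : Prop :=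
  ∃ P : Finset (Set (ℕ → Bool)), IsPartition P ∧
    mesh (↑P : Set (Set (ℕ → Bool))) < 1 / (m : ℝ) ∧
    ∃ q : ℕ, 0 < q ∧ m ∣ q ∧
      ∃ (k : ℕ) (s : Fin k → ℕ), (∀ i, 0 < s i) ∧
        ∃ e : {a // a ∈ P} ≃ (Σ i : Fin k, Fin (q.factorial + s i + q.factorial)),
          (∀ a b : {a // a ∈ P}, gammaEdge (⇑h) a.val b.val ↔
            ∃ heq : (e a).1 = (e b).1,
              dumbbellEdge q.factorial (s (e b).1) q.factorial
                (Fin.cast (by rw [heq]) (e a).2) (e b).2) ∧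
          (∀ i : Fin k,
            (∃ a : Set (ℕ → Bool), a.Nonempty ∧ IsClopen a ∧
              a ⊆ (e.symm ⟨i, ⟨0, by have := Nat.factorial_pos q; omega⟩⟩).val ∧
              (⇑h)^[q.factorial] '' a = a) ∧
            (∃ a : Set (ℕ → Bool), a.Nonempty ∧ IsClopen a ∧
              a ⊆ (e.symm ⟨i, ⟨q.factorial + s i,
                by have := Nat.factorial_pos q; omega⟩⟩).val ∧
              (⇑h)^[q.factorial] '' a = a))

/-! ### The metric and clopen sets -/

theorem cantorDist_le_of_agree {x y : ℕ → Bool} {N : ℕ} (hxy : ∀ i < N, x i = y i) :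
    cantorDist x y ≤ 1 / ((N : ℝ) + 1) := by
  classical
  unfold cantorDist
  split_ifs with h
  · have hN : N ≤ Nat.find h := by
      by_contra hlt
      exact Nat.find_spec h (hxy _ (not_le.mp hlt))
    apply one_div_le_one_div_of_le (by positivity)
    have : (N : ℝ) ≤ Nat.find h := by exact_mod_cast hN
    convert add_le_add_left this 1
  · positivity

theorem agree_of_cantorDist_lt {x y : ℕ → Bool} {N : ℕ}
    (hxy : cantorDist x y < 1 / ((N : ℝ) + 1)) : ∀ i < N, x i = y i := by
  classical
  intro i hi
  by_contra hne
  have h : ∃ n, x n ≠ y n := ⟨i, hne⟩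
  unfold cantorDist at hxy
  rw [dif_pos h] at hxy
  refine absurd hxy (not_lt.mpr ?_)
  apply one_div_le_one_div_of_le (by positivity)
  have hle : Nat.find h ≤ N := (Nat.find_min' h hne).trans hi.le
  have : ((Nat.find h : ℕ) : ℝ) ≤ N := by exact_mod_cast hle
  convert add_le_add_left this 1

theorem IsClopen.eventually_mem_iff {a : Set (ℕ → Bool)} (ha : IsClopen a) :
    ∀ᶠ N in Filter.atTop, ∀ x y : ℕ → Bool, (∀ i < N, x i = y i) → (x ∈ a ↔ y ∈ a) := by
  have key : ∃ N, ∀ x ∈ (Set.univ : Set (ℕ → Bool)), ∀ y, (∀ i < N, x i = y i) →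
      (x ∈ a ↔ y ∈ a) := by
    refine isCompact_univ.induction_on (p := fun s => ∃ N, ∀ x ∈ s, ∀ y : ℕ → Bool,
      (∀ i < N, x i = y i) → (x ∈ a ↔ y ∈ a)) ⟨0, by simp⟩ ?_ ?_ ?_
    · rintro s t hst ⟨N, hN⟩
      exact ⟨N, fun x hx => hN x (hst hx)⟩
    · rintro s t ⟨N, hN⟩ ⟨M, hM⟩
      refine ⟨max N M, fun x hx y hxy => ?_⟩
      rcases hx with hx | hx
      · exact hN x hx y fun i hi => hxy i (lt_max_of_lt_left hi)
      · exact hM x hx y fun i hi => hxy i (lt_max_of_lt_right hi)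
    · intro x _
      have hu : ∃ u : Set (ℕ → Bool), IsOpen u ∧ x ∈ u ∧ ∀ y ∈ u, (y ∈ a ↔ x ∈ a) := by
        by_cases hx : x ∈ a
        · exact ⟨a, ha.isOpen, hx, fun y hy => by simp [hx, hy]⟩
        · exact ⟨aᶜ, ha.compl.isOpen, hx, fun y hy => by
            have : y ∉ a := hy
            simp [hx, this]⟩
      obtain ⟨u, hu, hxu, hua⟩ := hu
      obtain ⟨v, ⟨z, n, rfl⟩, hxv, hvu⟩ :=
        (PiNat.isTopologicalBasis_cylinders (fun _ : ℕ => Bool)).exists_subset_of_mem_open hxu hu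
      refine ⟨PiNat.cylinder z n, mem_nhdsWithin_of_mem_nhds
        ((PiNat.isOpen_cylinder _ z n).mem_nhds hxv), n, fun w hw y hwy => ?_⟩
      rw [hua w (hvu hw), hua y (hvu fun i hi => (hwy i hi).symm.trans (hw i hi))]
  obtain ⟨N, hN⟩ := key
  filter_upwards [Filter.eventually_ge_atTop N] with M hM x y hxy
  exact hN x trivial y fun i hi => hxy i (hi.trans_le hM)

/-! ### Homeomorphisms between clopen subsets -/

/-- Prepend a bit to a binary sequence. -/
def consBit (b : Bool) (x : ℕ → Bool) : ℕ → Bool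
  | 0 => b
  | n + 1 => x n

theorem continuous_consBit (b : Bool) : Continuous (consBit b) := by
  refine continuous_pi fun n => ?_
  cases n with
  | zero => exact continuous_const
  | succ n => exact continuous_apply n

theorem consBit_injective (b : Bool) : Function.Injective (consBit b) := fun _ _ hxy =>
  funext fun n => congrFun hxy (n + 1)

theorem consBit_head_tail (x : ℕ → Bool) : consBit (x 0) (fun n => x (n + 1)) = x := by
  funext n
  cases n <;> rfl

theorem nonempty_homeomorph_sum_preimage_consBit {A : Set (ℕ → Bool)} (hA : IsClosed A) :
    Nonempty ((consBit false ⁻¹' A ⊕ consBit true ⁻¹' A : Type) ≃ₜ A) := by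
  have hc : ∀ b, CompactSpace (consBit b ⁻¹' A) := fun b =>
    isCompact_iff_compactSpace.mp (hA.preimage (continuous_consBit b)).isCompact
  have := hc false
  have := hc true
  let F : (consBit false ⁻¹' A ⊕ consBit true ⁻¹' A : Type) → A :=
    Sum.elim (fun x => ⟨consBit false x, x.2⟩) (fun x => ⟨consBit true x, x.2⟩)
  have hF : Continuous F := by
    refine Continuous.sumElim ?_ ?_
    · exact ((continuous_consBit _).comp continuous_subtype_val).subtype_mk _
    · exact ((continuous_consBit _).comp continuous_subtype_val).subtype_mk _
  have hb : Function.Bijective F := by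
    constructor
    · rintro (⟨x, hx⟩ | ⟨x, hx⟩) (⟨y, hy⟩ | ⟨y, hy⟩) hxy
      · have := consBit_injective _ (congrArg Subtype.val hxy)
        simpa using this
      · have := congrFun (congrArg Subtype.val hxy) 0
        simp [F, consBit] at this
      · have := congrFun (congrArg Subtype.val hxy) 0
        simp [F, consBit] at this
      · have := consBit_injective _ (congrArg Subtype.val hxy)
        simpa using this
    · rintro ⟨x, hx⟩
      have hx' := consBit_head_tail x
      cases h0 : x 0 <;> rw [h0] at hx'
      · exact ⟨Sum.inl ⟨_, by rw [Set.mem_preimage, hx']; exact hx⟩, Subtype.ext hx'⟩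
      · exact ⟨Sum.inr ⟨_, by rw [Set.mem_preimage, hx']; exact hx⟩, Subtype.ext hx'⟩
  exact ⟨(Equiv.ofBijective F hb).toHomeomorphOfContinuousClosed hF hF.isClosedMap⟩

theorem nonempty_homeomorph_sum_self :
    Nonempty (((ℕ → Bool) ⊕ (ℕ → Bool)) ≃ₜ (ℕ → Bool)) := by
  obtain ⟨e⟩ := nonempty_homeomorph_sum_preimage_consBit isClosed_univ
  exact ⟨((Homeomorph.Set.univ _).symm.sumCongr (Homeomorph.Set.univ _).symm).trans
    (e.trans (Homeomorph.Set.univ _))⟩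

theorem IsClopen.nonempty_homeomorph {A : Set (ℕ → Bool)} (hA : IsClopen A)
    (hne : A.Nonempty) : Nonempty (A ≃ₜ (ℕ → Bool)) := by
  obtain ⟨N, hN⟩ := hA.eventually_mem_iff.exists
  induction N generalizing A with
  | zero =>
    have : A = Set.univ := by
      obtain ⟨x, hx⟩ := hne
      exact Set.eq_univ_of_forall fun y => (hN x y (by simp)).mp hx
    subst this
    exact ⟨Homeomorph.Set.univ _⟩
  | succ N ih =>
    obtain ⟨e⟩ := nonempty_homeomorph_sum_preimage_consBit hA.isClosed
    have key : ∀ b, (consBit b ⁻¹' A).Nonempty →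
        Nonempty ((consBit b ⁻¹' A : Set _) ≃ₜ (ℕ → Bool)) := fun b hb => by
      refine ih (hA.preimage (continuous_consBit b)) hb fun x y hxy => hN _ _ fun i hi => ?_
      cases i with
      | zero => rfl
      | succ i => exact hxy i (by omega)
    rcases Set.eq_empty_or_nonempty (consBit false ⁻¹' A) with h0 | h0 <;>
      rcases Set.eq_empty_or_nonempty (consBit true ⁻¹' A) with h1 | h1
    · exfalso
      obtain ⟨x, hx⟩ := hne
      rcases e.symm ⟨x, hx⟩ with y | y
      · exact h0.subset y.2
      · exact h1.subset y.2
    · obtain ⟨f⟩ := key true h1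
      have : IsEmpty (consBit false ⁻¹' A) := Set.isEmpty_coe_sort.mpr h0
      exact ⟨e.symm.trans ((Homeomorph.emptySum _ _).trans f)⟩
    · obtain ⟨f⟩ := key false h0
      have : IsEmpty (consBit true ⁻¹' A) := Set.isEmpty_coe_sort.mpr h1
      exact ⟨e.symm.trans ((Homeomorph.sumEmpty _ _).trans f)⟩
    · obtain ⟨f⟩ := key false h0
      obtain ⟨g⟩ := key true h1
      obtain ⟨s⟩ := nonempty_homeomorph_sum_self
      exact ⟨e.symm.trans ((f.sumCongr g).trans s)⟩

theorem exists_isLocallyConstant_surjective (I : Type*) [Finite I] [Nonempty I] :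
    ∃ g : (ℕ → Bool) → I, IsLocallyConstant g ∧ Function.Surjective g := by
  have hcard : Nat.card I ≤ Nat.card (Fin (Nat.card I) → Bool) := by
    simpa using Nat.lt_two_pow_self.le
  obtain ⟨f⟩ : Nonempty (I ↪ (Fin (Nat.card I) → Bool)) := by
    have := Fintype.ofFinite I
    apply Function.Embedding.nonempty_of_card_le
    simpa [Nat.card_eq_fintype_card] using hcard
  refine ⟨fun x => Function.invFun f fun i => x i, ?_, ?_⟩
  · exact ((IsLocallyConstant.iff_continuous _).mpr
      (continuous_pi fun i : Fin (Nat.card I) =>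
        continuous_apply (A := fun _ : ℕ => Bool) (i : ℕ))).comp (Function.invFun f)
  · refine (Function.invFun_surjective f.injective).comp fun y => ?_
    refine ⟨fun n => if hn : n < Nat.card I then y ⟨n, hn⟩ else false, ?_⟩
    funext i
    simp

theorem IsLocallyConstant.continuous_glue_fibers {X Y J : Type*} [TopologicalSpace X]
    [TopologicalSpace Y] {f : X → J} (hf : IsLocallyConstant f) (F : ∀ j, f ⁻¹' {j} → Y)
    (hF : ∀ j, Continuous (F j)) : Continuous fun x => F (f x) ⟨x, rfl⟩ := by
  refine continuous_iff_continuousAt.mpr fun x₀ => ?_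
  have hr : Set.domRestrict (f ⁻¹' {f x₀}) (fun x => F (f x) ⟨x, rfl⟩) = F (f x₀) := by
    funext ⟨x, hx⟩
    have hx' : f x = f x₀ := hx
    have : ∀ j (hj : f x = j), F (f x) ⟨x, rfl⟩ = F j ⟨x, hj⟩ := by
      rintro j rfl
      rfl
    exact this _ hx'
  have hc : ContinuousOn (fun x => F (f x) ⟨x, rfl⟩) (f ⁻¹' {f x₀}) := by
    rw [continuousOn_iff_continuous_domRestrict, hr]
    exact hF _
  exact hc.continuousAt ((hf.isOpen_fiber _).mem_nhds rfl)

theorem IsLocallyConstant.exists_lift {J E : Type*} [Finite E] {f : (ℕ → Bool) → J}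
    (hf : IsLocallyConstant f) (ρ : E → J) (hρ : ∀ e, ∃ x, f x = ρ e)
    (hx : ∀ x, ∃ e, ρ e = f x) :
    ∃ D : (ℕ → Bool) → E, IsLocallyConstant D ∧ Function.Surjective D ∧ ∀ x, ρ (D x) = f x := by
  let _ : TopologicalSpace E := ⊥
  have : DiscreteTopology E := ⟨rfl⟩
  have key : ∀ j, ∃ G : f ⁻¹' {j} → E, Continuous G ∧ (∀ x, ρ (G x) = j) ∧
      ∀ e, ρ e = j → ∃ x, G x = e := by
    intro j
    rcases Set.eq_empty_or_nonempty (f ⁻¹' {j}) with h0 | h0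
    · have : IsEmpty (f ⁻¹' {j}) := Set.isEmpty_coe_sort.mpr h0
      refine ⟨isEmptyElim, continuous_of_const isEmptyElim, isEmptyElim, fun e he => ?_⟩
      obtain ⟨x, hxe⟩ := hρ e
      exact (h0.subset (hxe.trans he : f x = j)).elim
    · obtain ⟨c⟩ := (hf.isClopen_fiber j).nonempty_homeomorph h0
      obtain ⟨x, rfl⟩ := h0
      obtain ⟨e, he⟩ := hx x
      have : Nonempty {e // ρ e = f x} := ⟨⟨e, he⟩⟩
      obtain ⟨g, hg, hgs⟩ := exists_isLocallyConstant_surjective {e // ρ e = f x}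
      refine ⟨fun y => (g (c y)).1, continuous_subtype_val.comp (hg.continuous.comp c.continuous),
        fun y => (g (c y)).2, fun e he => ?_⟩
      obtain ⟨z, hz⟩ := hgs ⟨e, he⟩
      exact ⟨c.symm z, by simp [hz]⟩
  choose G hGc hGρ hGs using key
  refine ⟨fun x => G (f x) ⟨x, rfl⟩,
    (IsLocallyConstant.iff_continuous _).mpr (hf.continuous_glue_fibers G hGc), fun e => ?_,
    fun x => hGρ _ _⟩
  obtain ⟨⟨x, hxe⟩, hG⟩ := hGs (ρ e) e rfl
  refine ⟨x, ?_⟩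
  have : ∀ j (hj : f x = j), G (f x) ⟨x, rfl⟩ = G j ⟨x, hj⟩ := by
    rintro j rfl
    rfl
  exact (this _ hxe).trans hG

theorem IsLocallyConstant.exists_homeomorph_comp_eq {V : Type*} {f g : (ℕ → Bool) → V}
    (hf : IsLocallyConstant f) (hg : IsLocallyConstant g) (hfs : Function.Surjective f)
    (hgs : Function.Surjective g) :
    ∃ h : (ℕ → Bool) ≃ₜ (ℕ → Bool), ∀ x, g (h x) = f x := by
  have key : ∀ v, Nonempty ((f ⁻¹' {v} : Set _) ≃ₜ (g ⁻¹' {v} : Set _)) := by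
    intro v
    obtain ⟨c⟩ := (hf.isClopen_fiber v).nonempty_homeomorph (hfs v)
    obtain ⟨d⟩ := (hg.isClopen_fiber v).nonempty_homeomorph (hgs v)
    exact ⟨c.trans d.symm⟩
  obtain ⟨c⟩ := Classical.nonempty_pi.mpr key
  have cf : ∀ v (x : f ⁻¹' {v}), g (c v x) = v := fun v x => (c v x).2
  have cg : ∀ v (x : g ⁻¹' {v}), f ((c v).symm x) = v := fun v x => ((c v).symm x).2
  have aux : ∀ v w (y : ℕ → Bool) (hy : g y = v) (hv : v = w),
      (((c v).symm ⟨y, hy⟩ : f ⁻¹' {v}) : ℕ → Bool) = (c w).symm ⟨y, hy.trans hv⟩ := by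
    rintro v w y hy rfl
    rfl
  have aux' : ∀ v w (y : ℕ → Bool) (hy : f y = v) (hv : v = w),
      ((c v ⟨y, hy⟩ : g ⁻¹' {v}) : ℕ → Bool) = c w ⟨y, hy.trans hv⟩ := by
    rintro v w y hy rfl
    rfl
  refine ⟨{ toFun := fun x => c (f x) ⟨x, rfl⟩
            invFun := fun x => (c (g x)).symm ⟨x, rfl⟩
            left_inv := fun x => ?_
            right_inv := fun x => ?_
            continuous_toFun := hf.continuous_glue_fibers (fun v x => (c v x : ℕ → Bool))
              fun v => continuous_subtype_val.comp (c v).continuous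
            continuous_invFun := hg.continuous_glue_fibers
              (fun v x => ((c v).symm x : ℕ → Bool))
              fun v => continuous_subtype_val.comp (c v).symm.continuous }, fun x => cf _ _⟩
  · have h := aux _ _ (c (f x) ⟨x, rfl⟩ : ℕ → Bool) rfl (cf (f x) ⟨x, rfl⟩)
    exact h.trans (congrArg Subtype.val ((c (f x)).symm_apply_apply ⟨x, rfl⟩))
  · have h := aux' _ _ ((c (g x)).symm ⟨x, rfl⟩ : ℕ → Bool) rfl (cg (g x) ⟨x, rfl⟩)
    exact h.trans (congrArg Subtype.val ((c (g x)).apply_symm_apply ⟨x, rfl⟩))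

/-- A finite digraph mapping homomorphically, and onto every edge, to the digraph of `h` with
respect to a clopen partition is the digraph of a perturbation of `h`. -/
theorem exists_homeomorph_realizing {W V : Type*} [Finite V]
    (h : (ℕ → Bool) ≃ₜ (ℕ → Bool)) {p : (ℕ → Bool) → W} (hp : IsLocallyConstant p)
    (R : V → V → Prop) (hout : ∀ v, ∃ w, R v w) (hin : ∀ w, ∃ v, R v w) (φ : V → W)
    (hφ : ∀ v w, R v w → ∃ x, p x = φ v ∧ p (h x) = φ w)
    (hsurj : ∀ x, ∃ v w, R v w ∧ φ v = p x ∧ φ w = p (h x)) :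
    ∃ (h' : (ℕ → Bool) ≃ₜ (ℕ → Bool)) (l : (ℕ → Bool) → V), IsLocallyConstant l ∧
      Function.Surjective l ∧ (∀ x, p (h' x) = p (h x)) ∧ (∀ x, φ (l x) = p x) ∧
      ∀ v w, R v w ↔ ∃ x, l x = v ∧ l (h' x) = w := by
  let E := {e : V × V // R e.1 e.2}
  obtain ⟨D, hD, hDs, hDρ⟩ := IsLocallyConstant.exists_lift (E := E)
    (f := fun x => (p x, p (h x)))
    (hp.prodMk (hp.comp_continuous h.continuous)) (fun e => (φ e.1.1, φ e.1.2))
    (fun e => by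
      obtain ⟨x, hx, hx'⟩ := hφ _ _ e.2
      exact ⟨x, Prod.ext hx hx'⟩)
    (fun x => by
      obtain ⟨v, w, hR, hv, hw⟩ := hsurj x
      exact ⟨⟨(v, w), hR⟩, Prod.ext hv hw⟩)
  have hsrc : Function.Surjective fun x => (D x).1.1 := fun v => by
    obtain ⟨w, hR⟩ := hout v
    obtain ⟨x, hx⟩ := hDs ⟨(v, w), hR⟩
    exact ⟨x, by simp [hx]⟩
  have htgt : Function.Surjective fun x => (D x).1.2 := fun w => by
    obtain ⟨v, hR⟩ := hin w
    obtain ⟨x, hx⟩ := hDs ⟨(v, w), hR⟩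
    exact ⟨x, by simp [hx]⟩
  have hsrcl : IsLocallyConstant fun x => (D x).1.1 := hD.comp fun e : E => e.1.1
  have htgtl : IsLocallyConstant fun x => (D x).1.2 := hD.comp fun e : E => e.1.2
  obtain ⟨h', hh'⟩ := htgtl.exists_homeomorph_comp_eq hsrcl htgt hsrc
  have h1 : ∀ x, φ (D x).1.1 = p x := fun x => congrArg Prod.fst (hDρ x)
  have h2 : ∀ x, φ (D x).1.2 = p (h x) := fun x => congrArg Prod.snd (hDρ x)
  refine ⟨h', fun x => (D x).1.1, hsrcl, hsrc, fun x => ?_, h1, fun v w => ⟨fun hR => ?_, ?_⟩⟩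
  · rw [← h1, hh', h2]
  · obtain ⟨x, hx⟩ := hDs ⟨(v, w), hR⟩
    exact ⟨x, by simp [hx], by simp only [hh', hx]⟩
  · rintro ⟨x, rfl, rfl⟩
    simp only [hh']
    exact (D x).2

/-! ### Openness -/

theorem eventually_iterate_image_eq (h : (ℕ → Bool) ≃ₜ (ℕ → Bool)) {a : Set (ℕ → Bool)}
    (ha : IsClopen a) (r : ℕ) :
    ∀ᶠ N in Filter.atTop, ∀ h' : (ℕ → Bool) ≃ₜ (ℕ → Bool),
      (∀ x, ∀ i < N, h' x i = h x i) → (⇑h')^[r] '' a = (⇑h)^[r] '' a := by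
  have hclopen : ∀ j, IsClopen ((⇑h)^[j] '' a) := by
    intro j
    induction j with
    | zero => simpa using ha
    | succ j ih =>
      rw [Function.iterate_succ', Set.image_comp]
      exact ⟨h.isClosed_image.mpr ih.isClosed, h.isOpen_image.mpr ih.isOpen⟩
  induction r with
  | zero => simp
  | succ r ih =>
    filter_upwards [ih, (hclopen (r + 1)).eventually_mem_iff] with N hN hN' h' hh'
    have hmem : ∀ x, h' x ∈ (⇑h)^[r + 1] '' a ↔ x ∈ (⇑h)^[r] '' a := fun x => by
      rw [hN' _ _ (hh' x), Function.iterate_succ', Set.image_comp]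
      exact h.injective.mem_set_image
    rw [Function.iterate_succ' (⇑h'), Set.image_comp, hN h' hh']
    ext y
    obtain ⟨x, rfl⟩ := h'.surjective y
    rw [h'.injective.mem_set_image, hmem]

theorem BalancedDumbbellProp.exists_forall_agree {m : ℕ} {h : (ℕ → Bool) ≃ₜ (ℕ → Bool)}
    (hh : BalancedDumbbellProp m h) :
    ∃ N : ℕ, ∀ h' : (ℕ → Bool) ≃ₜ (ℕ → Bool), (∀ x, ∀ i < N, h' x i = h x i) →
      BalancedDumbbellProp m h' := by
  obtain ⟨P, hP, hmesh, q, hq, hmq, k, s, hs, e, he, hloop⟩ := hh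
  have hedge := (Filter.eventually_all_finset P).mpr fun a ha => (hP.1 a ha).1.eventually_mem_iff
  have hl : ∀ i, ∃ a : Set (ℕ → Bool), a.Nonempty ∧ IsClopen a ∧
      a ⊆ (e.symm ⟨i, ⟨0, by have := Nat.factorial_pos q; omega⟩⟩).val ∧
      (⇑h)^[q.factorial] '' a = a := fun i => (hloop i).1
  have hr : ∀ i, ∃ a : Set (ℕ → Bool), a.Nonempty ∧ IsClopen a ∧
      a ⊆ (e.symm ⟨i, ⟨q.factorial + s i, by have := Nat.factorial_pos q; omega⟩⟩).val ∧
      (⇑h)^[q.factorial] '' a = a := fun i => (hloop i).2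
  choose a hane hac hasub hah using hl
  choose b hbne hbc hbsub hbh using hr
  have hleft := Filter.eventually_all.mpr fun i =>
    eventually_iterate_image_eq h (hac i) q.factorial
  have hright := Filter.eventually_all.mpr fun i =>
    eventually_iterate_image_eq h (hbc i) q.factorial
  obtain ⟨N, hNe, hNl, hNr⟩ := (hedge.and (hleft.and hright)).exists
  refine ⟨N, fun h' hh' => ⟨P, hP, hmesh, q, hq, hmq, k, s, hs, e, fun c d => ?_, fun i =>
    ⟨⟨a i, hane i, hac i, hasub i, (hNl i h' hh').trans (hah i)⟩,
      ⟨b i, hbne i, hbc i, hbsub i, (hNr i h' hh').trans (hbh i)⟩⟩⟩⟩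
  rw [← he]
  simp only [gammaEdge, Set.Nonempty, Set.mem_inter_iff, Set.exists_mem_image,
    hNe d.1 d.2 _ _ (hh' _)]

/-! ### Dumbbells over finite digraphs -/

theorem Function.iterate_add_eq_of_card_le {α : Type*} [Fintype α] (f : α → α) {n r : ℕ}
    (hn : Fintype.card α ≤ n) (hr : ∀ d, 0 < d → d ≤ Fintype.card α → d ∣ r) (x : α) :
    f^[n + r] x = f^[n] x := by
  obtain ⟨i, j, hij, hf⟩ := Fintype.exists_ne_map_eq_of_card_lt
    (fun i : Fin (Fintype.card α + 1) => f^[i.val] x) (by simp)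
  wlog hlt : i < j generalizing i j
  · exact this j i hij.symm hf.symm (lt_of_le_of_ne (not_lt.mp hlt) hij.symm)
  have hlt' : i.val < j.val := hlt
  have hper : Function.IsPeriodicPt f (j.val - i.val) (f^[i.val] x) := by
    rw [Function.IsPeriodicPt, Function.IsFixedPt, ← Function.iterate_add_apply,
      Nat.sub_add_cancel hlt'.le]
    exact hf.symm
  have hperiod := (hper.trans_dvd (hr (j.val - i.val) (by omega) (by omega))).apply_iterate
    (n - i.val)
  rw [← Function.iterate_add_apply, Nat.sub_add_cancel (by omega)] at hperiod
  rw [Nat.add_comm n r, Function.iterate_add_apply]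
  exact hperiod

/-- The walk running once around a cycle of `T`, along `T` to `a`, across the edge `a → b`, along
`S` and once around a cycle of `S`. -/
def dumbbellWalk {W : Type*} (T S : W → W) (r : ℕ) (a b : W) (i : ℕ) : W :=
  if i < r then T^[2 * r - i] a
  else if i < 2 * r then T^[2 * r - 1 - i] a
  else S^[i - 2 * r] b

theorem dumbbellWalk_rel {W : Type*} {G : W → W → Prop} {T S : W → W} (hT : ∀ y, G (T y) y)
    (hS : ∀ y, G y (S y)) {r : ℕ} (hr : 0 < r) {a b : W} (hab : G a b)
    (hTr : T^[r + r] a = T^[r] a) (hSr : S^[r + r] b = S^[r] b) {i j : Fin (r + 2 * r + r)}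
    (hij : dumbbellEdge r (2 * r) r i j) :
    G (dumbbellWalk T S r a b i) (dumbbellWalk T S r a b j) := by
  have hT' : ∀ n k, n = k + 1 → G (T^[n] a) (T^[k] a) := by
    rintro n k rfl
    rw [Function.iterate_succ_apply']
    exact hT _
  have hS' : ∀ n k, k = n + 1 → G (S^[n] b) (S^[k] b) := by
    rintro n k rfl
    rw [Function.iterate_succ_apply']
    exact hS _
  obtain ⟨i, hi⟩ := i
  obtain ⟨j, hj⟩ := j
  simp only [dumbbellEdge] at hij
  rcases hij with ⟨rfl, hne⟩ | ⟨rfl, rfl⟩ | ⟨rfl, hjr⟩ | ⟨rfl, rfl⟩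
  · by_cases h1 : i + 1 < r
    · simp only [dumbbellWalk, h1, if_pos, show i < r by omega]
      exact hT' _ _ (by omega)
    · by_cases h2 : i + 1 < 2 * r
      · simp only [dumbbellWalk, h1, h2, if_true, if_false, show ¬ i < r by omega,
          show i < 2 * r by omega]
        exact hT' _ _ (by omega)
      · by_cases h3 : i < 2 * r
        · simp only [dumbbellWalk, h1, h2, h3, if_true, if_false, show ¬ i < r by omega,
            show 2 * r - 1 - i = 0 by omega, show i + 1 - 2 * r = 0 by omega]
          exact hab
        · simp only [dumbbellWalk, h1, h2, h3, if_false, show ¬ i < r by omega]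
          exact hS' _ _ (by omega)
  · simp only [dumbbellWalk, hr, if_true, show r - 1 < r by omega, show 2 * r - 0 = r + r by omega,
      hTr]
    exact hT' _ _ (by omega)
  · simp only [dumbbellWalk, hjr, hr, if_true, lt_irrefl, if_false, show r < 2 * r by omega,
      show 2 * r - 0 = r + r by omega, hTr]
    exact hT' _ _ (by omega)
  · simp only [dumbbellWalk, if_false, show ¬ r + 2 * r + r - 1 < r by omega,
      show ¬ r + 2 * r + r - 1 < 2 * r by omega, show ¬ r + 2 * r < r by omega,
      show ¬ r + 2 * r < 2 * r by omega, show r + 2 * r - 2 * r = r by omega]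
    rw [← hSr]
    exact hS' _ _ (by omega)

theorem dumbbellEdge_exists_right {r s t : ℕ} (hr : 0 < r) (ht : 0 < t) (i : Fin (r + s + t)) :
    ∃ j, dumbbellEdge r s t i j := by
  obtain ⟨i, hi⟩ := i
  by_cases h1 : i = r - 1
  · exact ⟨⟨0, by omega⟩, Or.inr (Or.inl ⟨h1, rfl⟩)⟩
  · by_cases h2 : i = r + s + t - 1
    · exact ⟨⟨r + s, by omega⟩, Or.inr (Or.inr (Or.inr ⟨h2, rfl⟩))⟩
    · exact ⟨⟨i + 1, by omega⟩, Or.inl ⟨rfl, by simp only; omega⟩⟩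

theorem dumbbellEdge_exists_left {r s t : ℕ} (hr : 0 < r) (j : Fin (r + s + t)) :
    ∃ i, dumbbellEdge r s t i j := by
  obtain ⟨j, hj⟩ := j
  by_cases h1 : j = 0
  · exact ⟨⟨r - 1, by omega⟩, Or.inr (Or.inl ⟨rfl, h1⟩)⟩
  · by_cases h2 : j = r
    · exact ⟨⟨0, by omega⟩, Or.inr (Or.inr (Or.inl ⟨rfl, h2⟩))⟩
    · exact ⟨⟨j - 1, by omega⟩, Or.inl ⟨by simp only; omega, by simp only; omega⟩⟩

/-- The edges of a balanced dumbbell together with a disjoint copy of each of its plates. -/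
def loopedDumbbellEdge (r s : ℕ) : Fin (r + s + r) ⊕ Bool × ZMod r →
    Fin (r + s + r) ⊕ Bool × ZMod r → Prop
  | .inl i, .inl j => dumbbellEdge r s r i j
  | .inr u, .inr v => u.1 = v.1 ∧ v.2 = u.2 + 1
  | _, _ => False

/-- Identify the copies of the plates (`false` for the left one) with the plates. -/
def collapseLoops (r s : ℕ) [NeZero r] : Fin (r + s + r) ⊕ Bool × ZMod r → Fin (r + s + r)
  | .inl i => i
  | .inr (false, z) => ⟨z.val, by have := ZMod.val_lt z; omega⟩
  | .inr (true, z) => ⟨r + s + z.val, by have := ZMod.val_lt z; omega⟩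

theorem ZMod.val_add_one_eq {r : ℕ} [NeZero r] (z : ZMod r) :
    (z + 1).val = z.val + 1 ∧ z.val + 1 ≠ r ∨ z.val = r - 1 ∧ (z + 1).val = 0 := by
  have hlt := ZMod.val_lt z
  have hval : (z + 1).val = (z.val + 1) % r := by
    rw [ZMod.val_add, ZMod.val_one_eq_one_mod, Nat.add_mod_mod]
  by_cases h : z.val + 1 = r
  · right
    rw [hval, h, Nat.mod_self]
    exact ⟨by omega, rfl⟩
  · left
    rw [hval, Nat.mod_eq_of_lt (by omega)]
    exact ⟨rfl, h⟩

theorem dumbbellEdge_collapseLoops {r s : ℕ} [NeZero r] {u v : Fin (r + s + r) ⊕ Bool × ZMod r}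
    (huv : loopedDumbbellEdge r s u v) :
    dumbbellEdge r s r (collapseLoops r s u) (collapseLoops r s v) := by
  have hr := Nat.pos_of_neZero r
  rcases u with i | ⟨x, z⟩ <;> rcases v with j | ⟨y, w⟩
  · exact huv
  · exact huv.elim
  · exact huv.elim
  · obtain ⟨hxy, hzw⟩ := huv
    simp only at hxy hzw
    subst hxy hzw
    have hz := ZMod.val_add_one_eq z
    cases x
    · simp only [collapseLoops, dumbbellEdge]
      omega
    · simp only [collapseLoops, dumbbellEdge]
      omega

theorem loopedDumbbellEdge_exists_right {r s : ℕ} (hr : 0 < r)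
    (u : Fin (r + s + r) ⊕ Bool × ZMod r) : ∃ v, loopedDumbbellEdge r s u v := by
  rcases u with i | ⟨x, z⟩
  · obtain ⟨j, hj⟩ := dumbbellEdge_exists_right hr hr i
    exact ⟨.inl j, hj⟩
  · exact ⟨.inr (x, z + 1), rfl, rfl⟩

theorem loopedDumbbellEdge_exists_left {r s : ℕ} (hr : 0 < r)
    (v : Fin (r + s + r) ⊕ Bool × ZMod r) : ∃ u, loopedDumbbellEdge r s u v := by
  rcases v with j | ⟨x, z⟩
  · obtain ⟨i, hi⟩ := dumbbellEdge_exists_left hr j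
    exact ⟨.inl i, hi⟩
  · exact ⟨.inr (x, z - 1), rfl, by simp⟩

theorem loopedDumbbellEdge_loop_iff {r s : ℕ} {u v : Fin (r + s + r) ⊕ Bool × ZMod r}
    (huv : loopedDumbbellEdge r s u v) (x : Bool) (z : ZMod r) :
    v = .inr (x, z + 1) ↔ u = .inr (x, z) := by
  rcases u with i | ⟨x', z'⟩ <;> rcases v with j | ⟨y, w⟩
  · simp
  · exact huv.elim
  · exact huv.elim
  · obtain ⟨hxy, hzw⟩ := huv
    simp only at hxy hzw
    subst hxy hzw
    simp

/-! ### Density -/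

theorem BalancedDumbbellProp.of_labelling {m q k s M : ℕ} (hm : 0 < m) (hq : 0 < q) (hmq : m ∣ q)
    (hs : 0 < s) (hmM : m ≤ M) (h : (ℕ → Bool) ≃ₜ (ℕ → Bool))
    {l : (ℕ → Bool) → Fin k × Fin (q.factorial + s + q.factorial)} (hl : IsLocallyConstant l)
    (hls : Function.Surjective l) (hfib : ∀ x y, l x = l y → ∀ i < M, x i = y i)
    (hedge : ∀ v w, (∃ x, l x = v ∧ l (h x) = w) ↔
      v.1 = w.1 ∧ dumbbellEdge q.factorial s q.factorial v.2 w.2)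
    (hloop : ∀ (i : Fin k) (j : Fin (q.factorial + s + q.factorial)),
      j.val = 0 ∨ j.val = q.factorial + s → ∃ a : Set (ℕ → Bool), a.Nonempty ∧ IsClopen a ∧
        a ⊆ l ⁻¹' {(i, j)} ∧ (⇑h)^[q.factorial] '' a = a) :
    BalancedDumbbellProp m h := by
  classical
  let P : Finset (Set (ℕ → Bool)) := Finset.univ.image fun v => l ⁻¹' {v}
  have hPmem : ∀ v, l ⁻¹' {v} ∈ P := fun v => Finset.mem_image_of_mem _ (Finset.mem_univ v)
  have hbij : Function.Bijective fun v => (⟨l ⁻¹' {v}, hPmem v⟩ : {a // a ∈ P}) := by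
    refine ⟨fun v w hvw => ?_, fun ⟨a, ha⟩ => ?_⟩
    · obtain ⟨x, rfl⟩ := hls v
      have hset : l ⁻¹' {l x} = l ⁻¹' {w} := congrArg Subtype.val hvw
      exact hset.subset (Set.mem_preimage.mpr rfl)
    · obtain ⟨v, -, rfl⟩ := Finset.mem_image.mp ha
      exact ⟨v, rfl⟩
  let E := Equiv.ofBijective _ hbij
  have hfibre : ∀ a ∈ P, ∃ v, a = l ⁻¹' {v} := fun a ha => by
    obtain ⟨v, -, rfl⟩ := Finset.mem_image.mp ha
    exact ⟨v, rfl⟩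
  refine ⟨P, ⟨fun a ha => ?_, fun a ha b hb hab => ?_, ?_⟩, ?_, q, hq, hmq, k, fun _ => s,
    fun _ => hs, E.symm.trans (Equiv.sigmaEquivProd _ _).symm, fun a b => ?_, fun i => ⟨?_, ?_⟩⟩
  · obtain ⟨v, rfl⟩ := hfibre a ha
    exact ⟨hl.isClopen_fiber v, hls v⟩
  · obtain ⟨v, rfl⟩ := hfibre a ha
    obtain ⟨w, rfl⟩ := hfibre b hb
    refine Disjoint.preimage _ (Set.disjoint_singleton.mpr ?_)
    rintro rfl
    exact hab rfl
  · exact Set.eq_univ_of_forall fun x => ⟨l ⁻¹' {l x}, hPmem _, rfl⟩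
  · have hM : (1 : ℝ) / (M + 1) < 1 / m := by
      apply one_div_lt_one_div_of_lt (by exact_mod_cast hm)
      have : (m : ℝ) ≤ M := by exact_mod_cast hmM
      linarith
    refine lt_of_le_of_lt (Real.sSup_le ?_ (by positivity)) hM
    rintro _ ⟨a, ha, rfl⟩
    refine Real.sSup_le ?_ (by positivity)
    rintro _ ⟨x, hx, y, hy, rfl⟩
    obtain ⟨v, rfl⟩ := hfibre a ha
    exact cantorDist_le_of_agree (hfib x y (hx.trans hy.symm))
  · obtain ⟨v, rfl⟩ := E.surjective a
    obtain ⟨w, rfl⟩ := E.surjective b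
    have hgamma : gammaEdge h (E v).1 (E w).1 ↔ ∃ x, l x = v ∧ l (h x) = w := by
      change (h '' (l ⁻¹' {v}) ∩ l ⁻¹' {w}).Nonempty ↔ _
      simp [Set.Nonempty]
    have hv : (E.symm.trans (Equiv.sigmaEquivProd _ _).symm) (E v) = ⟨v.1, v.2⟩ := by
      simp
    have hw : (E.symm.trans (Equiv.sigmaEquivProd _ _).symm) (E w) = ⟨w.1, w.2⟩ := by
      simp
    rw [hgamma, hedge]
    constructor
    · rintro ⟨h1, h2⟩
      refine ⟨by rw [hv, hw]; exact h1, ?_⟩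
      simpa [dumbbellEdge] using h2
    · rintro ⟨h1, h2⟩
      refine ⟨by rw [hv, hw] at h1; exact h1, ?_⟩
      simpa [dumbbellEdge] using h2
  · exact hloop i _ (Or.inl rfl)
  · exact hloop i _ (Or.inr rfl)

theorem iterate_image_eq_of_forall_mem_add_one_iff {r : ℕ}
    (h : (ℕ → Bool) ≃ₜ (ℕ → Bool)) {A : ZMod r → Set (ℕ → Bool)}
    (hA : ∀ x z, h x ∈ A (z + 1) ↔ x ∈ A z) (z : ZMod r) : (⇑h)^[r] '' A z = A z := by
  have key : ∀ (n : ℕ) x z, (⇑h)^[n] x ∈ A (z + n) ↔ x ∈ A z := by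
    intro n
    induction n with
    | zero => simp
    | succ n ih =>
      intro x z
      rw [Function.iterate_succ_apply', Nat.cast_succ, ← add_assoc, hA, ih]
  have hr : ∀ x, (⇑h)^[r] x ∈ A z ↔ x ∈ A z := fun x => by simpa using key r x z
  ext y
  obtain ⟨x, rfl⟩ := (h.surjective.iterate r) y
  rw [(h.injective.iterate r).mem_set_image, hr]

theorem exists_balancedDumbbellProp_agree {m : ℕ} (hm : 0 < m) (h : (ℕ → Bool) ≃ₜ (ℕ → Bool))
    {M : ℕ} (hmM : m ≤ M) :
    ∃ h' : (ℕ → Bool) ≃ₜ (ℕ → Bool), BalancedDumbbellProp m h' ∧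
      ∀ x, ∀ i < M, h' x i = h x i := by
  let W := Fin M → Bool
  let p : (ℕ → Bool) → W := fun x i => x i
  have hp : IsLocallyConstant p := (IsLocallyConstant.iff_continuous _).mpr
    (continuous_pi fun i : Fin M => continuous_apply (A := fun _ : ℕ => Bool) (i : ℕ))
  have hps : Function.Surjective p := fun y => by
    refine ⟨fun n => if hn : n < M then y ⟨n, hn⟩ else false, ?_⟩
    funext i
    simp [p]
  let G : W → W → Prop := fun a b => ∃ x, p x = a ∧ p (h x) = b
  have hS : ∀ a, ∃ b, G a b := fun a => by
    obtain ⟨x, rfl⟩ := hps a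
    exact ⟨_, x, rfl, rfl⟩
  have hT : ∀ b, ∃ a, G a b := fun b => by
    obtain ⟨x, rfl⟩ := hps b
    exact ⟨_, h.symm x, rfl, by simp⟩
  choose S hS using hS
  choose T hT using hT
  let q := m * Fintype.card W
  have hcard : 0 < Fintype.card W := Fintype.card_pos
  have hq : 0 < q := Nat.mul_pos hm hcard
  have hcq : Fintype.card W ≤ q := Nat.le_mul_of_pos_left _ hm
  obtain ⟨r, hrq⟩ : ∃ r, r = q.factorial := ⟨_, rfl⟩
  have hr : 0 < r := hrq ▸ q.factorial_pos
  have : NeZero r := ⟨hr.ne'⟩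
  have hcr : Fintype.card W ≤ r := hcq.trans (hrq ▸ q.self_le_factorial)
  have hdvd : ∀ d, 0 < d → d ≤ Fintype.card W → d ∣ r := fun d hd hdc =>
    hrq ▸ Nat.dvd_factorial hd (hdc.trans hcq)
  obtain ⟨k, ⟨c⟩⟩ := Finite.exists_equiv_fin {e : W × W // G e.1 e.2}
  let V := Fin k × (Fin (r + 2 * r + r) ⊕ Bool × ZMod r)
  let φ : V → W := fun v =>
    dumbbellWalk T S r (c.symm v.1).1.1 (c.symm v.1).1.2 (collapseLoops r (2 * r) v.2)
  let R : V → V → Prop := fun v w => v.1 = w.1 ∧ loopedDumbbellEdge r (2 * r) v.2 w.2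
  have hwalk : ∀ (i : Fin k) {j j' : Fin (r + 2 * r + r)}, dumbbellEdge r (2 * r) r j j' →
      G (dumbbellWalk T S r (c.symm i).1.1 (c.symm i).1.2 j)
        (dumbbellWalk T S r (c.symm i).1.1 (c.symm i).1.2 j') := fun i j j' hj =>
    dumbbellWalk_rel hT hS hr (c.symm i).2 (Function.iterate_add_eq_of_card_le T hcr hdvd _)
      (Function.iterate_add_eq_of_card_le S hcr hdvd _) hj
  obtain ⟨h', l, hl, hls, hph, hφl, hR⟩ := exists_homeomorph_realizing (V := V) h hp R
    (fun ⟨i, u⟩ => by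
      obtain ⟨v, hv⟩ := loopedDumbbellEdge_exists_right hr u
      exact ⟨(i, v), rfl, hv⟩)
    (fun ⟨i, u⟩ => by
      obtain ⟨v, hv⟩ := loopedDumbbellEdge_exists_left hr u
      exact ⟨(i, v), rfl, hv⟩)
    φ
    (fun ⟨i, u⟩ ⟨j, v⟩ huv => by
      obtain ⟨hij, huv⟩ := huv
      simp only at hij huv
      subst hij
      exact hwalk i (dumbbellEdge_collapseLoops huv))
    (fun x => by
      refine ⟨(c ⟨(p x, p (h x)), x, rfl, rfl⟩, .inl ⟨2 * r - 1, by omega⟩),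
        (c ⟨(p x, p (h x)), x, rfl, rfl⟩, .inl ⟨2 * r, by omega⟩),
        ⟨rfl, Or.inl ⟨?_, ?_⟩⟩, ?_, ?_⟩
      · simp only
        omega
      · simp only
        omega
      · simp [φ, dumbbellWalk, collapseLoops, show ¬ 2 * r - 1 < r by omega, hr]
      · simp [φ, dumbbellWalk, collapseLoops, show ¬ 2 * r < r by omega])
  refine ⟨h', ?_, fun x i hi => congrFun (hph x) ⟨i, hi⟩⟩
  have hcl : IsLocallyConstant fun x => ((l x).1, collapseLoops r (2 * r) (l x).2) :=
    hl.comp fun v : V => (v.1, collapseLoops r (2 * r) v.2)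
  have hRx : ∀ x, R (l x) (l (h' x)) := fun x => (hR _ _).mpr ⟨x, rfl, rfl⟩
  have hloop : ∀ (i : Fin k) (b : Bool), ∃ a : Set (ℕ → Bool), a.Nonempty ∧ IsClopen a ∧
      a ⊆ l ⁻¹' {(i, .inr (b, 0))} ∧ (⇑h')^[r] '' a = a := fun i b =>
    ⟨l ⁻¹' {(i, .inr (b, 0))}, hls _, hl.isClopen_fiber _, subset_rfl,
      iterate_image_eq_of_forall_mem_add_one_iff h' (A := fun z => l ⁻¹' {(i, .inr (b, z))})
        (fun x z => by
          have hx := hRx x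
          change l (h' x) = (i, .inr (b, z + 1)) ↔ l x = (i, .inr (b, z))
          exact Prod.ext_iff.trans ((and_congr (Eq.congr_left hx.1.symm)
            (loopedDumbbellEdge_loop_iff hx.2 b z)).trans
              (Prod.ext_iff (x := l x) (y := (i, .inr (b, z)))).symm)) 0⟩
  subst hrq
  refine BalancedDumbbellProp.of_labelling hm hq (Dvd.intro _ rfl) (s := 2 * q.factorial)
    (by omega) hmM h' hcl ?_ ?_ ?_ ?_
  · rintro ⟨i, j⟩
    obtain ⟨x, hx⟩ := hls (i, .inl j)
    exact ⟨x, by simp [hx, collapseLoops]⟩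
  · intro x y hxy i hi
    have hpxy : p x = p y := by
      rw [← hφl, ← hφl]
      simp only [Prod.mk.injEq] at hxy
      simp only [φ, hxy.1, hxy.2]
    exact congrFun hpxy ⟨i, hi⟩
  · rintro ⟨i, u⟩ ⟨j, v⟩
    constructor
    · rintro ⟨x, hx, hx'⟩
      simp only [Prod.mk.injEq] at hx hx'
      obtain ⟨h1, h2⟩ := hRx x
      have h3 := dumbbellEdge_collapseLoops h2
      rw [hx.2, hx'.2] at h3
      exact ⟨hx.1.symm.trans (h1.trans hx'.1), h3⟩
    · rintro ⟨hij, huv⟩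
      obtain ⟨x, hx, hx'⟩ := (hR (i, .inl u) (j, .inl v)).mp ⟨hij, huv⟩
      exact ⟨x, by simp [hx, collapseLoops], by simp [hx', collapseLoops]⟩
  · rintro i j (hj | hj)
    · obtain ⟨a, hane, hac, hal, hah⟩ := hloop i false
      refine ⟨a, hane, hac, fun x hx => ?_, hah⟩
      have hlx : l x = (i, .inr (false, 0)) := hal hx
      simp [hlx, collapseLoops, Fin.ext_iff, hj]
    · obtain ⟨a, hane, hac, hal, hah⟩ := hloop i true
      refine ⟨a, hane, hac, fun x hx => ?_, hah⟩
      have hlx : l x = (i, .inr (true, 0)) := hal hx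
      simp [hlx, collapseLoops, Fin.ext_iff, hj]

theorem Sm_open_and_dense (m : ℕ) (hm : 0 < m) :
    (∀ h : (ℕ → Bool) ≃ₜ (ℕ → Bool), BalancedDumbbellProp m h →
      ∃ ε : ℝ, 0 < ε ∧ ∀ h' : (ℕ → Bool) ≃ₜ (ℕ → Bool),
        (∀ σ, cantorDist (h' σ) (h σ) < ε) → BalancedDumbbellProp m h') ∧
    (∀ h : (ℕ → Bool) ≃ₜ (ℕ → Bool), ∀ ε : ℝ, 0 < ε →
      ∃ h' : (ℕ → Bool) ≃ₜ (ℕ → Bool),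
        BalancedDumbbellProp m h' ∧ ∀ σ, cantorDist (h' σ) (h σ) < ε) := by
  constructor
  · intro h hh
    obtain ⟨N, hN⟩ := hh.exists_forall_agree
    exact ⟨1 / ((N : ℝ) + 1), by positivity, fun h' hh' =>
      hN h' fun x => agree_of_cantorDist_lt (hh' x)⟩
  · intro h ε hε
    obtain ⟨n, hn⟩ := exists_nat_one_div_lt hε
    obtain ⟨h', hh', hagree⟩ := exists_balancedDumbbellProp_agree hm h (le_max_left m n)
    refine ⟨h', hh', fun x => lt_of_le_of_lt (cantorDist_le_of_agree fun i hi => ?_) hn⟩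
    exact hagree x i (lt_max_of_lt_right hi)
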